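/- Let K be an algebraically closed field of characteristic zero and let f, g ∈ K[x] be monic polynomials with n = deg f > deg g = m ≥ 1 and gcd(n,m) = 1. Then {f,g} is a basis of A = K[f,g]: the set of degrees d(A) = {deg h : h ∈ A, h ≠ 0} equals the additive submonoid ⟨n,m⟩ of ℕ generated by n and m. -/

import Mathlib

set_option synthInstance.maxHeartbeats 1000000
set_option maxHeartbeats 1000000

/-- The set of degrees of nonzero elements of a subalgebra `A ⊆ K[x]`. -/
def dSet (K : Type*) [Field K] (A : Subalgebra K (Polynomial K)) : Set ℕ :=
  {n | ∃ h ∈ A, h ≠ 0 ∧ h.natDegree = n}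

open Polynomial in
/-- Over `K[g]`, the ring `K[x]` is generated as a module by `1, x, …, x ^ (deg g - 1)`. -/
theorem exists_eq_sum_comp_mul_X_pow {R : Type*} [CommRing R] [Nontrivial R] {g : R[X]}
    (hg : g.Monic) (hm : 1 ≤ g.natDegree) (h : R[X]) :
    ∃ c : Fin g.natDegree → R[X], h = ∑ k, (c k).comp g * X ^ (k : ℕ) := by
  induction hd : h.natDegree using Nat.strong_induction_on generalizing h with
  | _ d ih =>
    by_cases hlt : h.natDegree < g.natDegree
    · refine ⟨fun k => C (h.coeff k), ?_⟩
      conv_lhs => rw [h.as_sum_range_C_mul_X_pow' hlt]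
      rw [Finset.sum_range]
      simp
    · have hq : (h /ₘ g).natDegree < d := by
        rw [natDegree_divByMonic h hg]
        omega
      obtain ⟨c, hc⟩ := ih _ hq _ rfl
      have hr : (h %ₘ g).natDegree < g.natDegree :=
        natDegree_modByMonic_lt h hg (by rintro rfl; simp at hm)
      refine ⟨fun k => C ((h %ₘ g).coeff k) + X * c k, ?_⟩
      calc
        h = h %ₘ g + g * (h /ₘ g) := (modByMonic_add_div h g).symm
        _ = ∑ k : Fin g.natDegree, C ((h %ₘ g).coeff k) * X ^ (k : ℕ)
            + g * ∑ k, (c k).comp g * X ^ (k : ℕ) := by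
          rw [← hc, ← Finset.sum_range fun k => C ((h %ₘ g).coeff k) * X ^ k,
            ← (h %ₘ g).as_sum_range_C_mul_X_pow' hr]
        _ = _ := by
          rw [Finset.mul_sum, ← Finset.sum_add_distrib]
          refine Finset.sum_congr rfl fun k _ => ?_
          simp only [add_comp, C_comp, mul_comp, X_comp]
          ring

open Polynomial in
/-- Any polynomial `f` is a root of a monic polynomial of degree `deg g` over `K[g]`. -/
theorem exists_monic_eval₂_comp_eq_zero {R : Type*} [CommRing R] [IsDomain R] {g : R[X]}
    (hg : g.Monic) (hm : 1 ≤ g.natDegree) (f : R[X]) :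
    ∃ P : R[X][X], P.Monic ∧ P.natDegree = g.natDegree ∧ P.eval₂ (compRingHom g) f = 0 := by
  choose A hA using fun i : Fin g.natDegree =>
    exists_eq_sum_comp_mul_X_pow hg hm (f * X ^ (i : ℕ))
  refine ⟨(Matrix.of A).charpoly, Matrix.charpoly_monic _, ?_, ?_⟩
  · simp [Matrix.charpoly_natDegree_eq_dim]
  · rw [← eval_map, ← Matrix.charpoly_map, Matrix.eval_charpoly,
      ← Matrix.exists_mulVec_eq_zero_iff]
    refine ⟨fun i => X ^ (i : ℕ), fun h => ?_, ?_⟩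
    · simpa using congrFun h ⟨0, hm⟩
    · ext1 i
      rw [Matrix.sub_mulVec, Pi.sub_apply, Pi.zero_apply, sub_eq_zero]
      simp only [Matrix.scalar_apply, Matrix.mulVec_diagonal]
      rw [hA i]
      simp [Matrix.mulVec, dotProduct]

open Polynomial in
/-- Every element of `K[f, g]` is a polynomial in `f` of degree less than `deg g` with
coefficients in `K[g]`. -/
theorem exists_eq_sum_comp_mul_pow_of_mem_adjoin {R : Type*} [CommRing R] [IsDomain R]
    {f g h : R[X]} (hg : g.Monic) (hm : 1 ≤ g.natDegree) (hh : h ∈ Algebra.adjoin R {f, g}) :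
    ∃ c : ℕ → R[X], h = ∑ i ∈ Finset.range g.natDegree, (c i).comp g * f ^ i := by
  obtain ⟨P, hP, hPdeg, hPf⟩ := exists_monic_eval₂_comp_eq_zero hg hm f
  obtain ⟨Q, hQ⟩ : ∃ Q : R[X][X], Q.eval₂ (compRingHom g) f = h := by
    induction hh using Algebra.adjoin_induction with
    | mem x hx =>
      rcases hx with rfl | rfl
      · exact ⟨X, by simp⟩
      · exact ⟨C X, by simp⟩
    | algebraMap r => exact ⟨C (C r), by simp⟩
    | add x y _ _ hx hy =>
      obtain ⟨p, rfl⟩ := hx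
      obtain ⟨q, rfl⟩ := hy
      exact ⟨p + q, eval₂_add _ _⟩
    | mul x y _ _ hx hy =>
      obtain ⟨p, rfl⟩ := hx
      obtain ⟨q, rfl⟩ := hy
      exact ⟨p * q, eval₂_mul _ _⟩
  have hdeg : (Q %ₘ P).natDegree < g.natDegree := by
    rw [← hPdeg]
    exact natDegree_modByMonic_lt Q hP (by rintro rfl; simp at hPdeg; omega)
  refine ⟨(Q %ₘ P).coeff, ?_⟩
  rw [← hQ, ← modByMonic_add_div Q P, eval₂_add, eval₂_mul, hPf, zero_mul, add_zero,
    eval₂_eq_sum_range' _ hdeg]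
  simp [modByMonic_add_div]

open Polynomial in
/-- If `deg f` and `deg g` are coprime, the terms of a polynomial in `f` of degree less than
`deg g` over `K[g]` have distinct degrees, so its degree is the degree of one of them. -/
theorem natDegree_sum_comp_mul_pow_mem_closure {R : Type*} [CommRing R] [IsDomain R]
    {f g : R[X]} (hcop : f.natDegree.Coprime g.natDegree) (c : ℕ → R[X]) :
    (∑ i ∈ Finset.range g.natDegree, (c i).comp g * f ^ i).natDegree ∈
      AddSubmonoid.closure {f.natDegree, g.natDegree} := by
  have hterm (i : ℕ) (hi : (c i).comp g * f ^ i ≠ 0) :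
      ((c i).comp g * f ^ i).natDegree = (c i).natDegree * g.natDegree + i * f.natDegree := by
    rw [natDegree_mul (left_ne_zero_of_mul hi) (right_ne_zero_of_mul hi), natDegree_comp,
      natDegree_pow]
  rw [natDegree_sum_eq_of_disjoint]
  · refine Finset.sup_induction (zero_mem _) (fun a ha b hb => ?_) fun i _ => ?_
    · rcases max_choice a b with h | h <;> simpa only [h] using ‹_›
    · by_cases hi : (c i).comp g * f ^ i = 0
      · simp [hi]
      · rw [hterm i hi, ← smul_eq_mul, ← smul_eq_mul]
        exact add_mem (nsmul_mem (AddSubmonoid.subset_closure (by simp)) _)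
          (nsmul_mem (AddSubmonoid.subset_closure (by simp)) _)
  · rintro i ⟨hi, hi0⟩ j ⟨hj, hj0⟩ hij heq
    simp only [Function.comp_apply, hterm i hi0, hterm j hj0] at heq
    have hmod : i * f.natDegree ≡ j * f.natDegree [MOD g.natDegree] := by
      simpa [Nat.ModEq] using congrArg (· % g.natDegree) heq
    exact hij ((hmod.cancel_right_of_coprime hcop.symm).eq_of_lt_of_lt
      (Finset.mem_range.1 hi) (Finset.mem_range.1 hj))

/-- If `K` is an algebraically closed field of characteristic zero, `f, g ∈ K[x]` are
monic with `deg f = n > deg g = m ≥ 1` and `gcd(n,m) = 1`, then `{f,g}` is a basis of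
`A = K[f,g]`: the set of degrees of nonzero elements of `A` is the submonoid of `ℕ`
generated by `n` and `m`. -/
theorem stmt_18 (K : Type*) [Field K] [IsAlgClosed K] [CharZero K]
    (f g : Polynomial K) (hf : f.Monic) (hg : g.Monic)
    (hdeg : g.natDegree < f.natDegree) (hm : 1 ≤ g.natDegree)
    (hcop : Nat.gcd f.natDegree g.natDegree = 1) :
    dSet K (Algebra.adjoin K ({f, g} : Set (Polynomial K)))
      = ↑(AddSubmonoid.closure ({f.natDegree, g.natDegree} : Set ℕ)) := by
  ext d
  constructor
  · rintro ⟨h, hh, -, rfl⟩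
    obtain ⟨c, rfl⟩ := exists_eq_sum_comp_mul_pow_of_mem_adjoin hg hm hh
    exact natDegree_sum_comp_mul_pow_mem_closure hcop c
  · intro hd
    obtain ⟨a, b, rfl⟩ := (AddSubmonoid.mem_closure_pair _ _ _).1 hd
    have hmonic := (hf.pow a).mul (hg.pow b)
    refine ⟨f ^ a * g ^ b, mul_mem (pow_mem (Algebra.subset_adjoin (by simp)) _)
      (pow_mem (Algebra.subset_adjoin (by simp)) _), hmonic.ne_zero, ?_⟩
    rw [(hf.pow a).natDegree_mul (hg.pow b), hf.natDegree_pow, hg.natDegree_pow,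
      smul_eq_mul, smul_eq_mul]
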